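/- Let E be a finite-dimensional real inner product space of dimension n ≥ 1, F a real normed vector space, and T : F → E a linear equivalence (bijective linear map). Let ε, δ > 0 and let S_ε, S_δ ⊆ F be sets such that: (i) ‖T(v)‖ ≤ 2ε for every v ∈ S_ε; (ii) T^{−1}(u) ∈ S_δ for every u ∈ E with ‖u‖ ≤ δ/4. Then for every M ≥ 0 such that ‖w‖ ≤ M for all w ∈ S_δ, one has ‖v‖ ≤ 8·n·(ε/δ)·M for every v ∈ S_ε. -/

import Mathlib

/-- Abstract form of Lemma 10.8: comparability of the extents of the sets
`S_ε, S_δ` (the linearized sets `B̃^{u,1}_p(z,·)`) via the linear equivalence `T`: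
any bound `M` on the norms over `S_δ` yields the bound `8n(ε/δ)M` over `S_ε`. -/
theorem stmt18 {E F : Type*} [NormedAddCommGroup E] [InnerProductSpace ℝ E]
    [FiniteDimensional ℝ E] [NormedAddCommGroup F] [NormedSpace ℝ F]
    (n : ℕ) (hn : 1 ≤ n) (hdim : Module.finrank ℝ E = n)
    (T : F ≃ₗ[ℝ] E) (ε δ : ℝ) (hε : 0 < ε) (hδ : 0 < δ)
    (Sε Sδ : Set F)
    (h1 : ∀ v ∈ Sε, ‖T v‖ ≤ 2 * ε)
    (h2 : ∀ u : E, ‖u‖ ≤ δ / 4 → T.symm u ∈ Sδ) :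
    ∀ M : ℝ, 0 ≤ M → (∀ w ∈ Sδ, ‖w‖ ≤ M) → ∀ v ∈ Sε, ‖v‖ ≤ 8 * n * (ε / δ) * M := by
  intro M hM hbound v hv
  have h_scale : 0 < δ / (8 * ε) := by positivity
  have h_mem : T.symm ((δ / (8 * ε)) • T v) ∈ Sδ := by
    apply h2
    rw [norm_smul, Real.norm_of_nonneg h_scale.le]
    calc δ / (8 * ε) * ‖T v‖ ≤ δ / (8 * ε) * (2 * ε) := by gcongr; exact h1 v hv
      _ = δ / 4 := by field_simp; norm_num
  have h_norm := hbound _ h_mem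
  rw [map_smul, T.symm_apply_apply, norm_smul, Real.norm_of_nonneg h_scale.le] at h_norm
  have h_one : (1 : ℝ) ≤ n := by exact_mod_cast hn
  calc ‖v‖ = 8 * (ε / δ) * (δ / (8 * ε) * ‖v‖) := by field_simp
    _ ≤ 8 * (ε / δ) * M := by gcongr
    _ ≤ n * (8 * (ε / δ) * M) := le_mul_of_one_le_left (by positivity) h_one
    _ = 8 * n * (ε / δ) * M := by ring
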